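/- arXiv:1111.6052 — 2 statements merged into one kernel-verified Lean document; each statement's English description precedes it below -/
import Mathlib

section
/- In the sequential untrusted-device model, assume p_min > 0. For a transcript (a,b,x,y) and 0 ≤ k ≤ n define M_k(a,b,x,y) = ∑_{j=1}^k ( c(a_j,b_j,x_j,y_j)/P_XY(x_j,y_j) − I_j(hist_j) ). Then: (i) for every round j and every history h = (a^{j−1},b^{j−1},x^{j−1},y^{j−1}) occurring with positive probability under P, the conditional expectation of c(A_j,B_j,X_j,Y_j)/P_XY(X_j,Y_j) given that the first j−1 rounds of the transcript equal h is exactly I_j(h), so (M_k)_{k=0}^n is a martingale with respect to the filtration generated by the transcript prefixes; and (ii) if moreover |I_j(h)| ≤ I_max for all j and h, then |M_j − M_{j−1}| ≤ c_max/p_min + I_max holds pointwise for every transcript and every j. -/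
open Finset
open scoped Classical

/-- A history of previous rounds: a list of tuples `(a, b, x, y)`. -/
abbrev Hist (𝔸 𝔹 𝕏 𝕐 : Type*) : Type _ := List (𝔸 × 𝔹 × 𝕏 × 𝕐)

/-- A transcript of `n` rounds of interaction: the outputs `a, b` and inputs `x, y`
of all rounds.  The components are `ω.1 = a`, `ω.2.1 = b`, `ω.2.2.1 = x`, `ω.2.2.2 = y`. -/
abbrev Transcript (𝔸 𝔹 𝕏 𝕐 : Type*) (n : ℕ) : Type _ :=
  (Fin n → 𝔸) × (Fin n → 𝔹) × (Fin n → 𝕏) × (Fin n → 𝕐)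

variable {𝔸 𝔹 𝕏 𝕐 : Type*} {n : ℕ}

/-- The data `(a_j, b_j, x_j, y_j)` of round `j` of a transcript (rounds are 0-based). -/
def roundData (ω : Transcript 𝔸 𝔹 𝕏 𝕐 n) (j : Fin n) : 𝔸 × 𝔹 × 𝕏 × 𝕐 :=
  (ω.1 j, ω.2.1 j, ω.2.2.1 j, ω.2.2.2 j)

/-- The history `hist_j` seen before (0-based) round `j`: the data of rounds `0, …, j−1`. -/
def histAt (ω : Transcript 𝔸 𝔹 𝕏 𝕐 n) (j : Fin n) : Hist 𝔸 𝔹 𝕏 𝕐 :=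
  List.ofFn (fun i : Fin j.val => roundData ω (Fin.castLE (le_of_lt j.2) i))

variable [Fintype 𝔸] [Fintype 𝔹] [Fintype 𝕏] [Fintype 𝕐]

/-- The Bell value `I_j(h) = ∑_{a,b,x,y} c(a,b,x,y)·Q_j(a,b|x,y,h)` of round `j`
given the history `h`. -/
noncomputable def roundBell (c : 𝔸 × 𝔹 × 𝕏 × 𝕐 → ℝ)
    (Q : ℕ → 𝔸 → 𝔹 → 𝕏 → 𝕐 → Hist 𝔸 𝔹 𝕏 𝕐 → ℝ) (j : ℕ) (h : Hist 𝔸 𝔹 𝕏 𝕐) : ℝ :=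
  ∑ a : 𝔸, ∑ b : 𝔹, ∑ x : 𝕏, ∑ y : 𝕐, c (a, b, x, y) * Q j a b x y h

/-- The average Bell value `Ī(a,b,x,y) = (1/n)·∑_j I_j(hist_j)` of a transcript. -/
noncomputable def Ibar (c : 𝔸 × 𝔹 × 𝕏 × 𝕐 → ℝ)
    (Q : ℕ → 𝔸 → 𝔹 → 𝕏 → 𝕐 → Hist 𝔸 𝔹 𝕏 𝕐 → ℝ) (ω : Transcript 𝔸 𝔹 𝕏 𝕐 n) : ℝ :=
  (1 / (n : ℝ)) * ∑ j : Fin n, roundBell c Q j (histAt ω j)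

/-- The estimated Bell value `Î(a,b,x,y) = (1/n)·∑_j c(a_j,b_j,x_j,y_j)/P_XY(x_j,y_j)`
of a transcript. -/
noncomputable def Ihat (c : 𝔸 × 𝔹 × 𝕏 × 𝕐 → ℝ) (PXY : 𝕏 × 𝕐 → ℝ)
    (ω : Transcript 𝔸 𝔹 𝕏 𝕐 n) : ℝ :=
  (1 / (n : ℝ)) * ∑ j : Fin n, c (roundData ω j) / PXY (ω.2.2.1 j, ω.2.2.2 j)

/-- The probability mass `P(a,b,x,y) = ∏_j P_XY(x_j,y_j)·Q_j(a_j,b_j|x_j,y_j,hist_j)`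
of a transcript. -/
noncomputable def transcriptProb (PXY : 𝕏 × 𝕐 → ℝ)
    (Q : ℕ → 𝔸 → 𝔹 → 𝕏 → 𝕐 → Hist 𝔸 𝔹 𝕏 𝕐 → ℝ) (ω : Transcript 𝔸 𝔹 𝕏 𝕐 n) : ℝ :=
  ∏ j : Fin n,
    PXY (ω.2.2.1 j, ω.2.2.2 j) * Q j (ω.1 j) (ω.2.1 j) (ω.2.2.1 j) (ω.2.2.2 j) (histAt ω j)

/-- The conditional probability `∏_j Q_j(a_j,b_j|x_j,y_j,hist_j)` of the outputs of
a transcript given its inputs. -/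
noncomputable def outputProb (Q : ℕ → 𝔸 → 𝔹 → 𝕏 → 𝕐 → Hist 𝔸 𝔹 𝕏 𝕐 → ℝ)
    (ω : Transcript 𝔸 𝔹 𝕏 𝕐 n) : ℝ :=
  ∏ j : Fin n, Q j (ω.1 j) (ω.2.1 j) (ω.2.2.1 j) (ω.2.2.2 j) (histAt ω j)

/-- Probability of an event `E` under a probability mass function `P` on a finite type. -/
noncomputable def Pr {Ω : Type*} [Fintype Ω] (P : Ω → ℝ) (E : Set Ω) : ℝ :=
  ∑ ω ∈ Finset.univ.filter (· ∈ E), P ω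

/-- Conditional probability `P[E | F] = P[E ∩ F] / P[F]`. -/
noncomputable def condPr {Ω : Type*} [Fintype Ω] (P : Ω → ℝ) (E F : Set Ω) : ℝ :=
  Pr P (E ∩ F) / Pr P F

/-- The martingale `M_k = ∑_{j<k} (c(a_j,b_j,x_j,y_j)/P_XY(x_j,y_j) − I_j(hist_j))`
associated with a transcript (rounds are 0-based, so `M_k` sums the first `k` rounds). -/
noncomputable def Mart (c : 𝔸 × 𝔹 × 𝕏 × 𝕐 → ℝ) (PXY : 𝕏 × 𝕐 → ℝ)
    (Q : ℕ → 𝔸 → 𝔹 → 𝕏 → 𝕐 → Hist 𝔸 𝔹 𝕏 𝕐 → ℝ) (k : ℕ)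
    (ω : Transcript 𝔸 𝔹 𝕏 𝕐 n) : ℝ :=
  ∑ j ∈ Finset.univ.filter (fun j : Fin n => (j : ℕ) < k),
    (c (roundData ω j) / PXY (ω.2.2.1 j, ω.2.2.2 j) - roundBell c Q j (histAt ω j))

/-- Conditional expectation `E[g | E] = (∑_{ω ∈ E} P(ω)·g(ω)) / P[E]`. -/
noncomputable def condExp {Ω : Type*} [Fintype Ω] (P : Ω → ℝ) (g : Ω → ℝ) (E : Set Ω) : ℝ :=
  (∑ ω ∈ Finset.univ.filter (· ∈ E), P ω * g ω) / Pr P E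

/-- The first `j` entries of a sequence of length `n`, as a list. -/
def prefixList {T : Type*} {m : ℕ} (s : Fin m → T) (j : Fin m) : List T :=
  List.ofFn (fun i : Fin j.val => s (Fin.castLE (le_of_lt j.2) i))

/-- The mass of a sequence whose entries are drawn one after the other, with weight `q h t`
for the entry `t` after the prefix `h`. -/
def seqProb {T : Type*} {m : ℕ} (q : List T → T → ℝ) (s : Fin m → T) : ℝ :=
  ∏ j, q (prefixList s j) (s j)

theorem prefixList_snoc_castSucc {T : Type*} {m : ℕ} (s : Fin m → T) (t : T) (j : Fin m) :
    prefixList (Fin.snoc s t : Fin (m + 1) → T) j.castSucc = prefixList s j := by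
  unfold prefixList
  refine congrArg List.ofFn (funext fun i => ?_)
  exact Fin.snoc_castSucc (α := fun _ => T) t s (Fin.castLE (le_of_lt j.2) i)

theorem prefixList_snoc_last {T : Type*} {m : ℕ} (s : Fin m → T) (t : T) :
    prefixList (Fin.snoc s t : Fin (m + 1) → T) (Fin.last m) = List.ofFn s := by
  unfold prefixList
  refine congrArg List.ofFn (funext fun i => ?_)
  exact Fin.snoc_castSucc (α := fun _ => T) t s i

theorem seqProb_snoc {T : Type*} {m : ℕ} (q : List T → T → ℝ) (s : Fin m → T) (t : T) :
    seqProb q (Fin.snoc s t : Fin (m + 1) → T) = seqProb q s * q (List.ofFn s) t := by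
  simp [seqProb, Fin.prod_univ_castSucc, prefixList_snoc_castSucc, prefixList_snoc_last]

theorem sum_snoc {T : Type*} [Fintype T] {m : ℕ} (F : (Fin (m + 1) → T) → ℝ) :
    ∑ s, F s = ∑ s : Fin m → T, ∑ t, F (Fin.snoc s t) := by
  rw [← (Fin.snocEquiv fun _ : Fin (m + 1) => T).sum_comp, Fintype.sum_prod_type_right]
  rfl

/-- Given the prefix `h`, the next entry of the sequence is distributed according to `q h`. -/
theorem sum_seqProb_mul_ite {T : Type*} [Fintype T] (q : List T → T → ℝ) {m : ℕ}
    (hq : ∀ h : List T, h.length < m → ∑ t, q h t = 1) (j : Fin m) (h : List T) (f : T → ℝ) :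
    ∑ s : Fin m → T, (if prefixList s j = h then seqProb q s * f (s j) else 0) =
      (∑ s : Fin m → T, if prefixList s j = h then seqProb q s else 0) * ∑ t, q h t * f t := by
  induction m with
  | zero => exact j.elim0
  | succ m ih =>
    have hs (s : Fin m → T) : ∑ t, q (List.ofFn s) t = 1 := hq _ (by simp)
    simp only [sum_snoc, seqProb_snoc]
    induction j using Fin.lastCases with
    | last =>
      simp only [prefixList_snoc_last, Fin.snoc_last, Finset.sum_mul]
      refine Finset.sum_congr rfl fun s _ => ?_
      rw [← Finset.sum_mul]
      split_ifs with hh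
      · rw [← Finset.mul_sum, hs, mul_one, Finset.mul_sum, hh]
        simp only [mul_assoc]
      · simp
    | cast j =>
      simp only [prefixList_snoc_castSucc, Fin.snoc_castSucc]
      have hsum (s : Fin m → T) (r : ℝ) :
          ∑ t, (if prefixList s j = h then seqProb q s * q (List.ofFn s) t * r else 0) =
            if prefixList s j = h then seqProb q s * r else 0 := by
        split_ifs
        · rw [← Finset.sum_mul, ← Finset.mul_sum, hs, mul_one]
        · simp
      have hsum' := fun s : Fin m → T => hsum s 1
      simp only [mul_one] at hsum'
      simp only [hsum, hsum']
      exact ih (fun h hh => hq h (by omega)) j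

/-- A transcript viewed as the sequence of its round data. -/
def transcriptEquiv (𝔸 𝔹 𝕏 𝕐 : Type*) (n : ℕ) :
    Transcript 𝔸 𝔹 𝕏 𝕐 n ≃ (Fin n → 𝔸 × 𝔹 × 𝕏 × 𝕐) where
  toFun := roundData
  invFun s := (fun i => (s i).1, fun i => (s i).2.1, fun i => (s i).2.2.1, fun i => (s i).2.2.2)
  left_inv _ := rfl
  right_inv _ := rfl

/-- The weight of the data of the next round after the history `h`. -/
def roundWeight (PXY : 𝕏 × 𝕐 → ℝ) (Q : ℕ → 𝔸 → 𝔹 → 𝕏 → 𝕐 → Hist 𝔸 𝔹 𝕏 𝕐 → ℝ)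
    (h : Hist 𝔸 𝔹 𝕏 𝕐) (t : 𝔸 × 𝔹 × 𝕏 × 𝕐) : ℝ :=
  PXY t.2.2 * Q h.length t.1 t.2.1 t.2.2.1 t.2.2.2 h

omit [Fintype 𝔸] [Fintype 𝔹] [Fintype 𝕏] [Fintype 𝕐] in
theorem length_histAt (ω : Transcript 𝔸 𝔹 𝕏 𝕐 n) (j : Fin n) : (histAt ω j).length = j := by
  simp [histAt]

omit [Fintype 𝔸] [Fintype 𝔹] [Fintype 𝕏] [Fintype 𝕐] in
theorem transcriptProb_eq_seqProb (PXY : 𝕏 × 𝕐 → ℝ)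
    (Q : ℕ → 𝔸 → 𝔹 → 𝕏 → 𝕐 → Hist 𝔸 𝔹 𝕏 𝕐 → ℝ) (ω : Transcript 𝔸 𝔹 𝕏 𝕐 n) :
    transcriptProb PXY Q ω = seqProb (roundWeight PXY Q) (roundData ω) := by
  refine Finset.prod_congr rfl fun j _ => ?_
  change _ = roundWeight PXY Q (histAt ω j) (roundData ω j)
  rw [roundWeight, length_histAt]
  rfl

theorem sum_roundWeight (PXY : 𝕏 × 𝕐 → ℝ) (hPXY1 : ∑ xy : 𝕏 × 𝕐, PXY xy = 1)
    (Q : ℕ → 𝔸 → 𝔹 → 𝕏 → 𝕐 → Hist 𝔸 𝔹 𝕏 𝕐 → ℝ) (h : Hist 𝔸 𝔹 𝕏 𝕐)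
    (hQ : ∀ x y, ∑ a : 𝔸, ∑ b : 𝔹, Q h.length a b x y h = 1) :
    ∑ t, roundWeight PXY Q h t = 1 := by
  have hxy (xy : 𝕏 × 𝕐) :
      ∑ a : 𝔸, ∑ b : 𝔹, PXY xy * Q h.length a b xy.1 xy.2 h = PXY xy := by
    simp only [← Finset.mul_sum, hQ, mul_one]
  calc ∑ t, roundWeight PXY Q h t
      = ∑ a : 𝔸, ∑ b : 𝔹, ∑ xy : 𝕏 × 𝕐, PXY xy * Q h.length a b xy.1 xy.2 h := by
        simp only [Fintype.sum_prod_type, roundWeight]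
    _ = ∑ a : 𝔸, ∑ xy : 𝕏 × 𝕐, ∑ b : 𝔹, PXY xy * Q h.length a b xy.1 xy.2 h :=
        Finset.sum_congr rfl fun a _ => Finset.sum_comm
    _ = ∑ xy : 𝕏 × 𝕐, ∑ a : 𝔸, ∑ b : 𝔹, PXY xy * Q h.length a b xy.1 xy.2 h :=
        Finset.sum_comm
    _ = 1 := by simp only [hxy, hPXY1]

theorem sum_roundWeight_mul_div (c : 𝔸 × 𝔹 × 𝕏 × 𝕐 → ℝ) (PXY : 𝕏 × 𝕐 → ℝ)
    (hPXY : ∀ xy, PXY xy ≠ 0) (Q : ℕ → 𝔸 → 𝔹 → 𝕏 → 𝕐 → Hist 𝔸 𝔹 𝕏 𝕐 → ℝ)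
    (h : Hist 𝔸 𝔹 𝕏 𝕐) :
    ∑ t, roundWeight PXY Q h t * (c t / PXY t.2.2) = roundBell c Q h.length h := by
  simp only [roundBell, Fintype.sum_prod_type, roundWeight]
  refine Finset.sum_congr rfl fun a _ => Finset.sum_congr rfl fun b _ =>
    Finset.sum_congr rfl fun x _ => Finset.sum_congr rfl fun y _ => ?_
  have hxy := hPXY (x, y)
  field_simp

theorem Pr_histAt_pos_length {P : Transcript 𝔸 𝔹 𝕏 𝕐 n → ℝ} {j : Fin n} {h : Hist 𝔸 𝔹 𝕏 𝕐}
    (hpos : 0 < Pr P {ω | histAt ω j = h}) : h.length = j := by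
  obtain ⟨ω, hω, -⟩ := Finset.exists_ne_zero_of_sum_ne_zero hpos.ne'
  have hh : histAt ω j = h := by simpa using hω
  rw [← hh, length_histAt]

theorem condExp_roundData (PXY : 𝕏 × 𝕐 → ℝ)
    (Q : ℕ → 𝔸 → 𝔹 → 𝕏 → 𝕐 → Hist 𝔸 𝔹 𝕏 𝕐 → ℝ)
    (hq : ∀ h : Hist 𝔸 𝔹 𝕏 𝕐, h.length < n → ∑ t, roundWeight PXY Q h t = 1)
    (j : Fin n) (h : Hist 𝔸 𝔹 𝕏 𝕐)
    (hpos : 0 < Pr (transcriptProb PXY Q) {ω : Transcript 𝔸 𝔹 𝕏 𝕐 n | histAt ω j = h})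
    (f : 𝔸 × 𝔹 × 𝕏 × 𝕐 → ℝ) :
    condExp (transcriptProb PXY Q) (fun ω => f (roundData ω j)) {ω | histAt ω j = h} =
      ∑ t, roundWeight PXY Q h t * f t := by
  rw [condExp, div_eq_iff hpos.ne', mul_comm, Pr, Finset.sum_filter, Finset.sum_filter]
  have key := sum_seqProb_mul_ite (roundWeight PXY Q) hq j h f
  simp only [← (transcriptEquiv 𝔸 𝔹 𝕏 𝕐 n).sum_comp] at key
  simp only [transcriptProb_eq_seqProb, Set.mem_ofPred_eq]
  convert key <;> rfl

theorem condExp_sub_of_eqOn {Ω : Type*} [Fintype Ω] (P f g : Ω → ℝ) (E : Set Ω) (r : ℝ)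
    (hg : ∀ ω ∈ E, g ω = r) (hE : Pr P E ≠ 0) :
    condExp P (fun ω => f ω - g ω) E = condExp P f E - r := by
  have hr : ∑ ω ∈ Finset.univ.filter (· ∈ E), P ω * g ω = Pr P E * r := by
    rw [Pr, Finset.sum_mul]
    exact Finset.sum_congr rfl fun ω hω => by rw [hg ω (Finset.mem_filter.mp hω).2]
  simp only [condExp, mul_sub, Finset.sum_sub_distrib]
  rw [hr, sub_div, mul_div_cancel_left₀ _ hE]

theorem Mart_succ_sub (c : 𝔸 × 𝔹 × 𝕏 × 𝕐 → ℝ) (PXY : 𝕏 × 𝕐 → ℝ)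
    (Q : ℕ → 𝔸 → 𝔹 → 𝕏 → 𝕐 → Hist 𝔸 𝔹 𝕏 𝕐 → ℝ) (j : Fin n) (ω : Transcript 𝔸 𝔹 𝕏 𝕐 n) :
    Mart c PXY Q ((j : ℕ) + 1) ω - Mart c PXY Q (j : ℕ) ω =
      c (roundData ω j) / PXY (ω.2.2.1 j, ω.2.2.2 j) - roundBell c Q j (histAt ω j) := by
  have hfilter : Finset.univ.filter (fun i : Fin n => (i : ℕ) < j + 1) =
      insert j (Finset.univ.filter fun i : Fin n => (i : ℕ) < j) := by
    ext i
    simp only [Finset.mem_filter, Finset.mem_univ, true_and, Finset.mem_insert, Fin.ext_iff]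
    omega
  rw [Mart, Mart, hfilter, Finset.sum_insert (by simp), add_sub_cancel_right]

/-- **The Bell-estimator increments form a bounded martingale.**
In the sequential untrusted-device model with `p_min > 0`:
(i) for every round `j` and every history `h` occurring with positive probability, the
conditional expectation of `c(A_j,B_j,X_j,Y_j)/P_XY(X_j,Y_j)` given that the first `j`
rounds of the transcript equal `h` is exactly `I_j(h)`; consequently `(M_k)_k` is a
martingale with respect to the filtration generated by the transcript prefixes, i.e. the
conditional expectation of the increment `M_{j+1} − M_j` given any positive-probability
prefix vanishes; and
(ii) if moreover `|I_j(h)| ≤ I_max` for all rounds and histories, then pointwise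
`|M_{j+1} − M_j| ≤ c_max/p_min + I_max`. -/
theorem bell_estimator_martingale
    [Nonempty 𝔸] [Nonempty 𝔹] [Nonempty 𝕏] [Nonempty 𝕐]
    (hn : 1 ≤ n)
    (c : 𝔸 × 𝔹 × 𝕏 × 𝕐 → ℝ) (PXY : 𝕏 × 𝕐 → ℝ)
    (hPXY0 : ∀ xy, 0 ≤ PXY xy) (hPXY1 : ∑ xy : 𝕏 × 𝕐, PXY xy = 1)
    (Q : ℕ → 𝔸 → 𝔹 → 𝕏 → 𝕐 → Hist 𝔸 𝔹 𝕏 𝕐 → ℝ)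
    (hQ0 : ∀ j a b x y h, 0 ≤ Q j a b x y h)
    (hQ1 : ∀ j < n, ∀ (x : 𝕏) (y : 𝕐) (h : Hist 𝔸 𝔹 𝕏 𝕐), h.length = j →
      ∑ a : 𝔸, ∑ b : 𝔹, Q j a b x y h = 1)
    (pmin cmax : ℝ)
    (hpmin : pmin = Finset.univ.inf' Finset.univ_nonempty PXY)
    (hcmax : cmax = Finset.univ.sup' Finset.univ_nonempty fun t => |c t|)
    (hpmin_pos : 0 < pmin)
    (Imax : ℝ)
    (P : Transcript 𝔸 𝔹 𝕏 𝕐 n → ℝ) (hP : P = transcriptProb PXY Q) :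
    -- (i) the conditional expectation of each estimator increment is the round Bell value
    (∀ (j : Fin n) (h : Hist 𝔸 𝔹 𝕏 𝕐), 0 < Pr P {ω | histAt ω j = h} →
      condExp P (fun ω => c (roundData ω j) / PXY (ω.2.2.1 j, ω.2.2.2 j))
          {ω | histAt ω j = h} = roundBell c Q j h) ∧
    -- hence `(M_k)_k` is a martingale for the prefix filtration:
    (∀ (j : Fin n) (h : Hist 𝔸 𝔹 𝕏 𝕐), 0 < Pr P {ω | histAt ω j = h} →
      condExp P (fun ω => Mart c PXY Q ((j : ℕ) + 1) ω - Mart c PXY Q (j : ℕ) ω)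
          {ω | histAt ω j = h} = 0) ∧
    -- (ii) bounded increments
    ((∀ j < n, ∀ h : Hist 𝔸 𝔹 𝕏 𝕐, h.length = j → |roundBell c Q j h| ≤ Imax) →
      ∀ (ω : Transcript 𝔸 𝔹 𝕏 𝕐 n) (j : Fin n),
        |Mart c PXY Q ((j : ℕ) + 1) ω - Mart c PXY Q (j : ℕ) ω| ≤ cmax / pmin + Imax) := by
  subst hP
  have hPmin (xy : 𝕏 × 𝕐) : pmin ≤ PXY xy := hpmin ▸ Finset.inf'_le _ (Finset.mem_univ xy)
  have hPpos (xy : 𝕏 × 𝕐) : 0 < PXY xy := hpmin_pos.trans_le (hPmin xy)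
  have hq (h : Hist 𝔸 𝔹 𝕏 𝕐) (hh : h.length < n) : ∑ t, roundWeight PXY Q h t = 1 :=
    sum_roundWeight PXY hPXY1 Q h fun x y => hQ1 _ hh x y h rfl
  have hcond (j : Fin n) (h : Hist 𝔸 𝔹 𝕏 𝕐)
      (hpos : 0 < Pr (transcriptProb PXY Q) {ω : Transcript 𝔸 𝔹 𝕏 𝕐 n | histAt ω j = h}) :
      condExp (transcriptProb PXY Q)
        (fun ω => c (roundData ω j) / PXY (ω.2.2.1 j, ω.2.2.2 j))
        {ω | histAt ω j = h} = roundBell c Q j h := by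
    rw [← Pr_histAt_pos_length hpos,
      ← sum_roundWeight_mul_div c PXY (fun xy => (hPpos xy).ne') Q h]
    exact condExp_roundData PXY Q hq j h hpos fun t => c t / PXY t.2.2
  refine ⟨hcond, fun j h hpos => ?_, fun hI ω j => ?_⟩
  · simp only [Mart_succ_sub]
    rw [condExp_sub_of_eqOn _ _ _ _ (roundBell c Q j h) (fun ω hω => by rw [hω]) hpos.ne',
      hcond j h hpos, sub_self]
  · rw [Mart_succ_sub]
    refine (abs_sub _ _).trans (add_le_add ?_ (hI j j.2 _ (length_histAt ω j)))
    rw [abs_div, abs_of_pos (hPpos _)]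
    have hc : |c (roundData ω j)| ≤ cmax :=
      hcmax ▸ Finset.le_sup' (fun t => |c t|) (Finset.mem_univ _)
    exact div_le_div₀ ((abs_nonneg _).trans hc) hc hpmin_pos (hPmin _)
end

section
/- Let Ω be a finite type equipped with a probability mass function P, let 𝕏 be a finite type and 𝕃 a finite type of cardinality m, let X : Ω → 𝕏 and L : Ω → 𝕃 be random variables, let G ⊆ Ω be an event with P[G] > 0, and let t ≥ 0. Then the conditional probability, given G, of the set of all ω ∈ Ω such that P[X = X(ω) and G] > 0 and P[L = L(ω) | X = X(ω) and G] ≤ t, is at most m·t. -/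
open Finset
open scoped Classical

theorem Pr_nonneg {Ω : Type*} [Fintype Ω] {P : Ω → ℝ} (hP : ∀ ω, 0 ≤ P ω) (E : Set Ω) :
    0 ≤ Pr P E :=
  Finset.sum_nonneg fun ω _ => hP ω

theorem Pr_mono {Ω : Type*} [Fintype Ω] {P : Ω → ℝ} (hP : ∀ ω, 0 ≤ P ω) {E F : Set Ω}
    (h : E ⊆ F) : Pr P E ≤ Pr P F :=
  Finset.sum_le_sum_of_subset_of_nonneg
    (Finset.monotone_filter_right _ fun _ _ hω => h hω) fun ω _ _ => hP ω

theorem sum_Pr_fiber_inter {Ω α : Type*} [Fintype Ω] [Fintype α] (P : Ω → ℝ) (Y : Ω → α)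
    (E : Set Ω) : ∑ a, Pr P ({ω | Y ω = a} ∩ E) = Pr P E := by
  unfold Pr
  rw [← Finset.sum_fiberwise (Finset.univ.filter (· ∈ E)) Y P]
  refine Finset.sum_congr rfl fun a _ => Finset.sum_congr ?_ fun _ _ => rfl
  ext ω
  simp [and_comm]

/-- **Unlikely-label bound.**
Let `𝕃` have cardinality `m`, let `G` be an event of positive probability and `t ≥ 0`.
The conditional probability, given `G`, of the set of all `ω` such that
`P[X = X(ω) and G] > 0` and `P[L = L(ω) | X = X(ω) and G] ≤ t` is at most `m·t`. -/
theorem condPr_unlikely_label_le {Ω 𝕏 𝕃 : Type*} [Fintype Ω] [Fintype 𝕏] [Fintype 𝕃]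
    (m : ℕ) (hm : Fintype.card 𝕃 = m)
    (P : Ω → ℝ) (hP0 : ∀ ω, 0 ≤ P ω) (hP1 : ∑ ω, P ω = 1)
    (X : Ω → 𝕏) (L : Ω → 𝕃) (G : Set Ω) (hG : 0 < Pr P G)
    (t : ℝ) (ht : 0 ≤ t) :
    condPr P {ω : Ω | 0 < Pr P ({ω' | X ω' = X ω} ∩ G) ∧
        condPr P {ω' | L ω' = L ω} ({ω' | X ω' = X ω} ∩ G) ≤ t} G ≤ m * t := by
  rw [condPr, div_le_iff₀ hG]
  set S : Set Ω := {ω : Ω | 0 < Pr P ({ω' | X ω' = X ω} ∩ G) ∧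
    condPr P {ω' | L ω' = L ω} ({ω' | X ω' = X ω} ∩ G) ≤ t}
  have fiber_le (x : 𝕏) (l : 𝕃) :
      Pr P ({ω | L ω = l} ∩ ({ω | X ω = x} ∩ (S ∩ G))) ≤ t * Pr P ({ω | X ω = x} ∩ G) := by
    rcases Set.eq_empty_or_nonempty ({ω | L ω = l} ∩ ({ω | X ω = x} ∩ (S ∩ G))) with h | h
    · rw [h]
      simpa [Pr] using mul_nonneg ht (Pr_nonneg hP0 ({ω | X ω = x} ∩ G))
    · obtain ⟨ω, rfl, rfl, ⟨hpos, hle⟩, -⟩ := h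
      rw [condPr, div_le_iff₀ hpos] at hle
      refine (Pr_mono hP0 ?_).trans hle
      exact Set.inter_subset_inter_right _
        (Set.inter_subset_inter_right _ Set.inter_subset_right)
  calc Pr P (S ∩ G)
      = ∑ x, ∑ l, Pr P ({ω | L ω = l} ∩ ({ω | X ω = x} ∩ (S ∩ G))) := by
        simp only [sum_Pr_fiber_inter]
    _ ≤ ∑ x, ∑ _l : 𝕃, t * Pr P ({ω | X ω = x} ∩ G) :=
        Finset.sum_le_sum fun x _ => Finset.sum_le_sum fun l _ => fiber_le x l
    _ = m * t * Pr P G := by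
        simp only [Finset.sum_const, Finset.card_univ, hm, nsmul_eq_mul, ← Finset.mul_sum,
          sum_Pr_fiber_inter, mul_assoc]
end
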